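/- For every nonzero vector y ∈ ℂ^{d+1}, the matrix Φ(y) has rank exactly E = (m−1)d; equivalently, the kernel of the linear map Φ(y) : ℂ^{md−1} → ℂ^{E+1} has dimension exactly d−1. (Thus the matrices Φ(y), y ≠ 0, form a space of (E+1)×(md−1) matrices of linear forms of constant corank 1, attaining Westwick's bound.) -/

import Mathlib

open Polynomial in
/-- Polynomial attached to a finite coefficient vector, with binomial weights. -/
noncomputable def binPoly (N : ℕ) (g : Fin (N + 1) → ℂ) : ℂ[X] :=
  ∑ b : Fin (N + 1), Polynomial.monomial b.1 ((N.choose b.1 : ℂ) * g b)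

lemma binPoly_coeff (N : ℕ) (g : Fin (N + 1) → ℂ) (n : ℕ) :
    (binPoly N g).coeff n = if h : n < N + 1 then (N.choose n : ℂ) * g ⟨n, h⟩ else 0 := by
  unfold binPoly
  rw [Polynomial.finsetSum_coeff]
  simp only [Polynomial.coeff_monomial]
  split_ifs with h
  · rw [Finset.sum_eq_single ⟨n, h⟩]
    · simp
    · intro b _ hb
      rw [if_neg]
      intro h'
      exact hb (Fin.ext h')
    · simp
  · apply Finset.sum_eq_zero
    intro b _
    rw [if_neg]
    have := b.2
    omega

lemma binPoly_natDegree_le (N : ℕ) (g : Fin (N + 1) → ℂ) : (binPoly N g).natDegree ≤ N := by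
  rw [Polynomial.natDegree_le_iff_coeff_eq_zero]
  intro n hn
  rw [binPoly_coeff, dif_neg (by omega)]

lemma binPoly_eq_zero {N : ℕ} {g : Fin (N + 1) → ℂ} (h : binPoly N g = 0) : g = 0 := by
  funext b
  have h1 := binPoly_coeff N g b.1
  rw [h, dif_pos b.2] at h1
  have : (N.choose b.1 : ℂ) ≠ 0 := by
    exact_mod_cast (Nat.choose_pos (Nat.lt_succ_iff.mp b.2)).ne'
  simpa [this] using h1.symm

lemma exists_binPoly (N : ℕ) (P : Polynomial ℂ) (h : P.natDegree ≤ N) :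
    ∃ g : Fin (N + 1) → ℂ, binPoly N g = P := by
  refine ⟨fun b => P.coeff b.1 / (N.choose b.1 : ℂ), ?_⟩
  ext n
  rw [binPoly_coeff]
  split_ifs with hn
  · have : (N.choose n : ℂ) ≠ 0 := by
      exact_mod_cast (Nat.choose_pos (Nat.lt_succ_iff.mp hn)).ne'
    field_simp
  · rw [Polynomial.coeff_eq_zero_of_natDegree_lt (by omega)]

/-- The (homogenised) Jacobian of `F` and `G`. -/
noncomputable def jac (k : ℕ) (F G : Polynomial ℂ) : Polynomial ℂ :=
  F * (Polynomial.X * Polynomial.derivative G)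
    - Polynomial.C (k : ℂ) * ((Polynomial.X * Polynomial.derivative F) * G)

lemma coeff_X_mul_deriv (F : Polynomial ℂ) (n : ℕ) :
    (Polynomial.X * Polynomial.derivative F).coeff n = n * F.coeff n := by
  cases n with
  | zero => simp
  | succ n => rw [Polynomial.coeff_X_mul, Polynomial.coeff_derivative]; push_cast; ring

lemma jac_coeff (k : ℕ) (F G : Polynomial ℂ) (n : ℕ) :
    (jac k F G).coeff n = ∑ b ∈ Finset.range (n + 1),
      F.coeff (n - b) * G.coeff b * ((b : ℂ) - k * ((n - b : ℕ) : ℂ)) := by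
  unfold jac
  rw [mul_comm F, mul_comm _ G, Polynomial.coeff_sub, Polynomial.coeff_C_mul,
    Polynomial.coeff_mul, Polynomial.coeff_mul,
    Finset.Nat.sum_antidiagonal_eq_sum_range_succ_mk,
    Finset.Nat.sum_antidiagonal_eq_sum_range_succ_mk, Finset.mul_sum, ← Finset.sum_sub_distrib]
  apply Finset.sum_congr rfl
  intro b _
  simp only [coeff_X_mul_deriv]
  ring

lemma jac_pow (k : ℕ) (F : Polynomial ℂ) : jac k F (F ^ k) = 0 := by
  unfold jac
  cases k with
  | zero => simp
  | succ k =>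
    rw [Polynomial.derivative_pow_succ]
    push_cast
    simp only [map_add, Polynomial.C_1, map_natCast]
    ring

lemma jac_inj (k : ℕ) (F G : Polynomial ℂ) (hF : F ≠ 0) (h : jac k F G = 0)
    (hG : G.coeff (k * F.natDegree) = 0) : G = 0 := by
  by_contra hG0
  have h1 : (jac k F G).coeff (F.natDegree + G.natDegree) = 0 := by rw [h]; simp
  have hd : ∀ P : Polynomial ℂ, (Polynomial.X * Polynomial.derivative P).natDegree ≤ P.natDegree := by
    intro P
    rw [Polynomial.natDegree_le_iff_coeff_eq_zero]
    intro n hn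
    rw [coeff_X_mul_deriv, Polynomial.coeff_eq_zero_of_natDegree_lt hn, mul_zero]
  unfold jac at h1
  rw [Polynomial.coeff_sub, Polynomial.coeff_C_mul,
    Polynomial.coeff_mul_add_eq_of_natDegree_le le_rfl (hd G),
    Polynomial.coeff_mul_add_eq_of_natDegree_le (hd F) le_rfl, coeff_X_mul_deriv, coeff_X_mul_deriv] at h1
  have hf : F.coeff F.natDegree ≠ 0 := by simpa using hF
  have hg : G.coeff G.natDegree ≠ 0 := by simpa using hG0
  have h2 : F.coeff F.natDegree * G.coeff G.natDegree *
      ((G.natDegree : ℂ) - k * F.natDegree) = 0 := by linear_combination h1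
  have h3 : (G.natDegree : ℂ) = ((k * F.natDegree : ℕ) : ℂ) := by
    rcases mul_eq_zero.mp h2 with h2 | h2
    · exact absurd h2 (mul_ne_zero hf hg)
    · push_cast; linear_combination h2
  rw [← Nat.cast_injective h3] at hG
  exact hg hG

lemma choose_step (N a : ℕ) : ((N : ℤ) - a) * (N.choose a : ℤ) = (a + 1) * (N.choose (a + 1) : ℤ) := by
  have h := Nat.choose_succ_right_eq N a
  by_cases hN : a ≤ N
  · zify [hN] at h
    linear_combination -h
  · rw [Nat.choose_eq_zero_of_lt (by omega), Nat.choose_eq_zero_of_lt (by omega)]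
    simp

/-- Closed form of the coefficients. -/
lemma c_closed (d m : ℕ) (hd : 2 ≤ d) (hm : 2 ≤ m)
    (c : ℕ → ℕ → ℤ)
    (h11 : c 1 1 = -1) (h21 : c 2 1 = 1)
    (hrec1 : ∀ j, 2 ≤ j → j ≤ m * d - 1 →
      c 1 j = ((d : ℤ) - j + 1) * c 1 (j - 1))
    (hrec2 : ∀ j, 2 ≤ j → j ≤ m * d - 1 → ∀ i, 2 ≤ i → i ≤ j →
      c i j = ((d : ℤ) - j + i) * c i (j - 1)
        + ((((m - 1) * d : ℕ) : ℤ) - i + 2) * c (i - 1) (j - 1))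
    (hrec3 : ∀ j, 2 ≤ j → j ≤ m * d - 1 →
      c (j + 1) j = ((((m - 1) * d : ℕ) : ℤ) - j + 1) * c j (j - 1))
    (n : ℕ) (hn : n + 1 ≤ m * d - 1) : ∀ a b : ℕ, a + b = n + 1 →
      (((m - 1) * d : ℕ) : ℤ) * c (b + 1) (n + 1) =
        (n.factorial : ℤ) * d.choose a * ((m - 1) * d).choose b * ((b : ℤ) - ((m - 1 : ℕ) : ℤ) * a) := by
  obtain ⟨k, rfl⟩ : ∃ k, m = k + 1 := ⟨m - 1, by omega⟩
  simp only [Nat.add_sub_cancel] at *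
  set E := k * d with hE
  induction n with
  | zero =>
    intro a b hab
    rcases Nat.eq_zero_or_pos a with ha | ha
    · obtain rfl : b = 1 := by omega
      subst ha
      simp [h21]
    · obtain rfl : a = 1 := by omega
      obtain rfl : b = 0 := by omega
      simp [h11, hE]; ring
  | succ n ih =>
    have ih := ih (by omega)
    have hfac : ((n + 1).factorial : ℤ) = (n + 1) * n.factorial := by
      rw [Nat.factorial_succ]; push_cast; ring
    intro a b hab
    rw [hfac]
    rcases a with _ | a
    · obtain rfl : b = n + 2 := by omega
      have h1 := hrec3 (n + 2) (by omega) hn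
      have h2 := ih 0 (n + 1) (by omega)
      have h3 := choose_step E (n + 1)
      simp only [show n + 2 - 1 = n + 1 by omega] at h1
      rw [show n + 1 + 1 = n + 2 by rfl] at *
      rw [h1]
      push_cast at *
      linear_combination ((E : ℤ) - (n + 2) + 1) * h2 + (n.factorial : ℤ) * d.choose 0 * (n + 1) * h3
    · rcases b with _ | b
      · obtain rfl : a = n + 1 := by omega
        have h1 := hrec1 (n + 2) (by omega) hn
        have h2 := ih (n + 1) 0 (by omega)
        have h3 := choose_step d (n + 1)
        simp only [show n + 2 - 1 = n + 1 by omega] at h1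
        rw [show n + 1 + 1 = n + 2 by rfl] at *
        rw [zero_add, h1]
        rw [zero_add] at h2
        push_cast at *
        linear_combination ((d : ℤ) - (n + 2) + 1) * h2 - (n.factorial : ℤ) * E.choose 0 * k * (n + 1) * h3
      · obtain rfl : n = a + b := by omega
        have h1 := hrec2 (a + b + 2) (by omega) hn (b + 2) (by omega) (by omega)
        have h2 := ih a (b + 1) (by omega)
        have h3 := ih (a + 1) b (by omega)
        have h4 := choose_step d a
        have h5 := choose_step E b
        simp only [show a + b + 2 - 1 = a + b + 1 by omega, show b + 2 - 1 = b + 1 by omega] at h1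
        simp only [show b + 1 + 1 = b + 2 by rfl, show a + b + 1 + 1 = a + b + 2 by rfl] at *
        rw [h1]
        push_cast at *
        linear_combination ((d : ℤ) - a) * h2 + ((E : ℤ) - b) * h3
          + ((a + b).factorial : ℤ) * E.choose (b + 1) * (b + 1 - k * a) * h4
          + ((a + b).factorial : ℤ) * d.choose (a + 1) * (b - k * (a + 1)) * h5


open Finset Matrix

/-- The `(E+1) × (md-1)` matrix of linear forms `Φ(y)`, with entries
`c_{i,j} · y_{j-i+2}` (1-based indices) when `1 ≤ j-i+2 ≤ d+1`, and `0` otherwise. -/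
noncomputable def Phi (d m : ℕ) (c : ℕ → ℕ → ℤ) (y : Fin (d + 1) → ℂ) :
    Matrix (Fin ((m - 1) * d + 1)) (Fin (m * d - 1)) ℂ :=
  fun i j =>
    if h : i.1 ≤ j.1 + 1 ∧ j.1 + 1 ≤ i.1 + d then
      (c (i.1 + 1) (j.1 + 1) : ℂ) * y ⟨j.1 + 1 - i.1, by omega⟩
    else 0

/-- For every nonzero `y ∈ ℂ^{d+1}`, the matrix `Φ(y)` has rank exactly `E = (m-1)d`;
equivalently, the kernel of `Φ(y) : ℂ^{md-1} → ℂ^{E+1}` has dimension exactly `d-1`. -/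
theorem constant_corank_one (d m : ℕ) (hd : 2 ≤ d) (hm : 2 ≤ m)
    (c : ℕ → ℕ → ℤ)
    (hzero : ∀ i j, 1 ≤ j → j ≤ m * d - 1 → (i = 0 ∨ j + 1 < i) → c i j = 0)
    (h11 : c 1 1 = -1) (h21 : c 2 1 = 1)
    (hrec1 : ∀ j, 2 ≤ j → j ≤ m * d - 1 →
      c 1 j = ((d : ℤ) - j + 1) * c 1 (j - 1))
    (hrec2 : ∀ j, 2 ≤ j → j ≤ m * d - 1 → ∀ i, 2 ≤ i → i ≤ j →
      c i j = ((d : ℤ) - j + i) * c i (j - 1)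
        + ((((m - 1) * d : ℕ) : ℤ) - i + 2) * c (i - 1) (j - 1))
    (hrec3 : ∀ j, 2 ≤ j → j ≤ m * d - 1 →
      c (j + 1) j = ((((m - 1) * d : ℕ) : ℤ) - j + 1) * c j (j - 1)) :
    ∀ y : Fin (d + 1) → ℂ, y ≠ 0 →
      (Phi d m c y).rank = (m - 1) * d ∧
      Module.finrank ℂ (LinearMap.ker (Phi d m c y).mulVecLin) = d - 1 := by
  intro y hy
  have hmd : m * d = (m - 1) * d + d := by
    obtain ⟨k, rfl⟩ : ∃ k, m = k + 1 := ⟨m - 1, by omega⟩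
    simp only [Nat.add_sub_cancel]; ring
  have hEpos : 0 < (m - 1) * d := Nat.mul_pos (by omega) (by omega)
  have hclosed := c_closed d m hd hm c h11 h21 hrec1 hrec2 hrec3
  set F := binPoly d y with hFdef
  have hF : F ≠ 0 := fun h => hy (binPoly_eq_zero h)
  have hFdeg : F.natDegree ≤ d := binPoly_natDegree_le d y
  have key : ∀ (g : Fin ((m - 1) * d + 1) → ℂ) (j : Fin (m * d - 1)),
      (((m - 1) * d : ℕ) : ℂ) * ((Phi d m c y)ᵀ *ᵥ g) j =
        (j.1.factorial : ℂ) * (jac (m - 1) F (binPoly ((m - 1) * d) g)).coeff (j.1 + 1) := by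
    intro g j
    have hj := j.2
    set f : ℕ → ℂ := fun b => if b ≤ j.1 + 1 then
      (j.1.factorial : ℂ) * (F.coeff (j.1 + 1 - b) * (binPoly ((m - 1) * d) g).coeff b *
        ((b : ℂ) - ((m - 1 : ℕ) : ℂ) * ((j.1 + 1 - b : ℕ) : ℂ))) else 0 with hf
    have hL : (((m - 1) * d : ℕ) : ℂ) * ((Phi d m c y)ᵀ *ᵥ g) j
        = ∑ b ∈ Finset.range ((m - 1) * d + 1), f b := by
      rw [← Fin.sum_univ_eq_sum_range]
      simp only [Matrix.mulVec, dotProduct, Matrix.transpose_apply]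
      rw [Finset.mul_sum]
      apply Finset.sum_congr rfl
      intro i _
      simp only [hf, Phi]
      by_cases h1 : i.1 ≤ j.1 + 1
      · by_cases h2 : j.1 + 1 ≤ i.1 + d
        · rw [dif_pos ⟨h1, h2⟩, if_pos h1, hFdef, binPoly_coeff, binPoly_coeff,
            dif_pos (by omega), dif_pos i.2]
          have h3 := hclosed j.1 (by omega) (j.1 + 1 - i.1) i.1 (by omega)
          have h4 := congrArg (fun z : ℤ => (z : ℂ)) h3
          simp only [Int.cast_mul, Int.cast_sub, Int.cast_natCast] at h4
          simp only [Fin.eta]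
          linear_combination (y ⟨j.1 + 1 - i.1, by omega⟩ * g i) * h4
        · rw [dif_neg (fun h => h2 h.2), if_pos h1, hFdef, binPoly_coeff, dif_neg (by omega)]
          simp
      · rw [dif_neg (fun h => h1 h.1), if_neg h1]
        simp
    have hR : (j.1.factorial : ℂ) * (jac (m - 1) F (binPoly ((m - 1) * d) g)).coeff (j.1 + 1)
        = ∑ b ∈ Finset.range (j.1 + 1 + 1), f b := by
      rw [jac_coeff, Finset.mul_sum]
      apply Finset.sum_congr rfl
      intro b hb
      rw [Finset.mem_range] at hb
      simp only [hf]
      rw [if_pos (by omega)]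
    rw [hL, hR]
    have e1 : ∑ b ∈ Finset.range ((m - 1) * d + 1), f b = ∑ b ∈ Finset.range (m * d + 1), f b := by
      apply Finset.sum_subset
      · intro x hx
        simp only [Finset.mem_range] at *
        omega
      · intro x _ hx
        simp only [Finset.mem_range] at hx
        simp only [hf]
        rw [binPoly_coeff _ _ x, dif_neg hx]
        simp
    have e2 : ∑ b ∈ Finset.range (j.1 + 1 + 1), f b = ∑ b ∈ Finset.range (m * d + 1), f b := by
      apply Finset.sum_subset
      · intro x hx
        simp only [Finset.mem_range] at *
        omega
      · intro x _ hx
        simp only [Finset.mem_range] at hx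
        simp only [hf]
        rw [if_neg (by omega)]
    rw [e1, e2]
  have hEC : (((m - 1) * d : ℕ) : ℂ) ≠ 0 := by exact_mod_cast hEpos.ne'
  have kmem : ∀ g : Fin ((m - 1) * d + 1) → ℂ,
      g ∈ LinearMap.ker (Phi d m c y)ᵀ.mulVecLin ↔ jac (m - 1) F (binPoly ((m - 1) * d) g) = 0 := by
    intro g
    rw [LinearMap.mem_ker, Matrix.mulVecLin_apply]
    constructor
    · intro h
      ext n
      rw [Polynomial.coeff_zero]
      rcases n with _ | n
      · rw [jac_coeff]; simp
      · by_cases hn : n < m * d - 1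
        · have h1 := key g ⟨n, hn⟩
          rw [h] at h1
          have : (n.factorial : ℂ) ≠ 0 := by exact_mod_cast n.factorial_ne_zero
          simpa [this] using h1.symm
        · rw [jac_coeff]
          apply Finset.sum_eq_zero
          intro b _
          by_cases hb : b ≤ (m - 1) * d
          · by_cases hb2 : n + 1 - b ≤ d
            · have hb3 : b = (m - 1) * d := by omega
              have hb4 : n + 1 - b = d := by omega
              rw [hb4, hb3]
              push_cast
              ring
            · rw [Polynomial.coeff_eq_zero_of_natDegree_lt (by omega : F.natDegree < n + 1 - b)]
              simp
          · rw [binPoly_coeff _ _ b, dif_neg (by omega)]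
            simp
    · intro h
      funext j
      have h1 := key g j
      rw [h, Polynomial.coeff_zero, mul_zero] at h1
      exact (mul_eq_zero.mp h1).resolve_left hEC
  have hker : Module.finrank ℂ (LinearMap.ker (Phi d m c y)ᵀ.mulVecLin) = 1 := by
    obtain ⟨g0, hg0⟩ := exists_binPoly ((m - 1) * d) (F ^ (m - 1))
      (Polynomial.natDegree_pow_le.trans (Nat.mul_le_mul_left _ hFdeg))
    have hg0k : g0 ∈ LinearMap.ker (Phi d m c y)ᵀ.mulVecLin := by
      rw [kmem, hg0, jac_pow]
    have hg0ne : g0 ≠ 0 := by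
      rintro rfl
      have : binPoly ((m - 1) * d) 0 = 0 := by simp [binPoly]
      rw [this] at hg0
      exact pow_ne_zero _ hF hg0.symm
    have hlt : (m - 1) * F.natDegree < (m - 1) * d + 1 :=
      Nat.lt_succ_of_le (Nat.mul_le_mul_left _ hFdeg)
    have hinj : ∀ g ∈ LinearMap.ker (Phi d m c y)ᵀ.mulVecLin,
        g ⟨(m - 1) * F.natDegree, hlt⟩ = 0 → g = 0 := by
      intro g hg h0
      apply binPoly_eq_zero
      apply jac_inj (m - 1) F _ hF ((kmem g).mp hg)
      rw [binPoly_coeff, dif_pos hlt, h0, mul_zero]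
    have ht : g0 ⟨(m - 1) * F.natDegree, hlt⟩ ≠ 0 := fun h => hg0ne (hinj g0 hg0k h)
    apply finrank_eq_one (⟨g0, hg0k⟩ : LinearMap.ker (Phi d m c y)ᵀ.mulVecLin)
    · intro h
      exact hg0ne (congrArg Subtype.val h)
    · rintro ⟨g, hg⟩
      refine ⟨g ⟨(m - 1) * F.natDegree, hlt⟩ / g0 ⟨(m - 1) * F.natDegree, hlt⟩, ?_⟩
      apply Subtype.ext
      have := hinj (((g ⟨(m - 1) * F.natDegree, hlt⟩ / g0 ⟨(m - 1) * F.natDegree, hlt⟩) • g0) - g)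
        (Submodule.sub_mem _ (Submodule.smul_mem _ _ hg0k) hg) (by simp [ht])
      exact sub_eq_zero.mp this
  have hrank : (Phi d m c y).rank = (m - 1) * d := by
    rw [← Matrix.rank_transpose]
    have := LinearMap.finrank_range_add_finrank_ker (Phi d m c y)ᵀ.mulVecLin
    rw [hker, Module.finrank_fin_fun] at this
    unfold Matrix.rank
    omega
  refine ⟨hrank, ?_⟩
  have := LinearMap.finrank_range_add_finrank_ker (Phi d m c y).mulVecLin
  rw [Module.finrank_fin_fun] at this
  unfold Matrix.rank at hrank
  omega
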